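/- arXiv:2410.01894 — 3 statements merged into one kernel-verified Lean document; each statement's English description precedes it below -/
import Mathlib

section
/- Let p be a prime and for n ≥ 0 let F_n ∈ ℤ[T_0, T_1, T_2, …] be the n-th Frobenius polynomial of p-typical Witt vectors, i.e., the unique integral polynomials such that Φ_n(F_0, F_1, …) = Φ_{n+1}(T_0, T_1, …) for all n, where Φ_n = ∑_{j=0}^{n} p^j T_j^{p^{n-j}} is the n-th ghost polynomial. Then the constant coefficient of F_n is 0, and for every index j, the coefficient of the degree-one monomial T_j in F_n is congruent modulo p² to p if j = n+1 and congruent to 0 modulo p² otherwise. (Equivalently: the differential of the Witt vector Frobenius at the origin satisfies F*dT_n ≡ p·dT_{n+1} mod p².) -/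
open MvPolynomial in
theorem aux_coeff (j : ℕ) (f : MvPolynomial ℕ ℤ) :
    coeff (Finsupp.single j 1) f = constantCoeff (pderiv j f) := by
  induction f using MvPolynomial.induction_on' with
  | monomial u a =>
    rw [pderiv_monomial, constantCoeff_monomial, coeff_monomial]
    by_cases h : u = Finsupp.single j 1
    · subst h; simp
    · rw [if_neg h]
      by_cases h2 : u - Finsupp.single j 1 = 0
      · have h3 : u ≤ Finsupp.single j 1 := tsub_eq_zero_iff_le.mp h2
        have h4 : u j = 0 := by
          by_contra h5
          apply h
          apply le_antisymm h3
          rw [Finsupp.single_le_iff]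
          omega
        simp [h4]
      · rw [if_neg (fun e => h2 (by simpa using e))]
  | add p q hp hq => simp [hp, hq]

/-- Let `p` be a prime and `F n ∈ ℤ[T₀,T₁,…]` the Frobenius polynomials of
`p`-typical Witt vectors, i.e. any (necessarily unique) family of integral polynomials with
`Φₙ(F₀,F₁,…) = Φₙ₊₁(T₀,T₁,…)` for all `n`, where `Φₙ = ∑_{j=0}^n p^j Tⱼ^{p^{n-j}}` is the `n`-th
ghost polynomial (`wittPolynomial p ℤ n`).  Then the constant coefficient of `F n` is `0`, and
for every `j` the coefficient of the degree-one monomial `Tⱼ` in `F n` is congruent mod `p²` to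
`p` if `j = n+1` and to `0` otherwise. -/
theorem frobeniusPoly_linear_coeff_mod_sq (p : ℕ) (hp : p.Prime)
    (F : ℕ → MvPolynomial ℕ ℤ)
    (hF : ∀ n : ℕ, MvPolynomial.bind₁ F (wittPolynomial p ℤ n) = wittPolynomial p ℤ (n + 1)) :
    ∀ n : ℕ,
      MvPolynomial.constantCoeff (F n) = 0 ∧
      ∀ j : ℕ, MvPolynomial.coeff (Finsupp.single j 1) (F n) ≡
        (if j = n + 1 then (p : ℤ) else 0) [ZMOD (p : ℤ) ^ 2] := by
  have hp0 : (p : ℤ) ≠ 0 := by exact_mod_cast hp.ne_zero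
  have hpow : ∀ k : ℕ, p ^ k ≠ 0 := fun k => pow_ne_zero _ hp.ne_zero
  have hF' : ∀ n, ∑ i ∈ Finset.range (n + 1), MvPolynomial.C ((p : ℤ) ^ i) * F i ^ p ^ (n - i)
      = ∑ i ∈ Finset.range (n + 1 + 1), MvPolynomial.C ((p : ℤ) ^ i) *
        MvPolynomial.X i ^ p ^ (n + 1 - i) := by
    intro n
    have := hF n
    rw [wittPolynomial_eq_sum_C_mul_X_pow, wittPolynomial_eq_sum_C_mul_X_pow] at this
    rw [← this]
    simp [MvPolynomial.bind₁_X_right]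
  have hc : ∀ n, MvPolynomial.constantCoeff (F n) = 0 := by
    intro n
    induction n using Nat.strong_induction_on with
    | _ n ih =>
      have h := congrArg MvPolynomial.constantCoeff (hF' n)
      rw [map_sum, map_sum, Finset.sum_range_succ, Finset.sum_eq_zero,
        Finset.sum_eq_zero] at h
      · simpa [hp.ne_zero] using h
      · intro i hi
        simp [hp.ne_zero]
      · intro i hi
        simp [ih i (Finset.mem_range.mp hi), hp.ne_zero]
  have key : ∀ (G : MvPolynomial ℕ ℤ) (j k i : ℕ), MvPolynomial.constantCoeff G = 0 → k ≠ 0 →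
      MvPolynomial.constantCoeff (MvPolynomial.pderiv j
        (MvPolynomial.C ((p : ℤ) ^ i) * G ^ p ^ k)) = 0 := by
    intro G j k i hG hk
    have h1 : p ^ k - 1 ≠ 0 := by
      have := Nat.one_lt_pow hk hp.one_lt
      omega
    rw [MvPolynomial.pderiv_C_mul, MvPolynomial.pderiv_pow]
    simp [hG, h1]
  intro n
  refine ⟨hc n, fun j => ?_⟩
  have h := congrArg (fun f => MvPolynomial.constantCoeff (MvPolynomial.pderiv j f)) (hF' n)
  simp only [map_sum] at h
  rw [Finset.sum_range_succ, Finset.sum_range_succ _ (n + 1), Finset.sum_eq_zero,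
    Finset.sum_eq_zero] at h
  · have h2 : MvPolynomial.coeff (Finsupp.single j 1) (F n) = if j = n + 1 then (p : ℤ) else 0 := by
      rw [aux_coeff]
      simp only [Nat.sub_self, pow_zero, pow_one, MvPolynomial.pderiv_C_mul, zero_add,
        MvPolynomial.pderiv_X, map_mul, MvPolynomial.constantCoeff_C,
        MvPolynomial.smul_eq_C_mul] at h
      apply mul_left_cancel₀ (pow_ne_zero n hp0)
      rw [h]
      by_cases hj : j = n + 1
      · subst hj; simp [pow_succ]
      · simp [hj, Pi.single_apply, Ne.symm hj]
    rw [h2]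
  · intro i hi
    have := Finset.mem_range.mp hi
    exact key _ _ _ _ (by simp) (by omega)
  · intro i hi
    have := Finset.mem_range.mp hi
    exact key _ _ _ _ (hc i) (by omega)
end

section
/- Let p be a prime and consider the free associative algebra over 𝔽_p on generators x_1, …, x_p, equipped with the commutator bracket ⁅a,b⁆ = a·b - b·a. Then the following identity holds: ∑_{σ ∈ Σ_p, σ(1)=1} ⁅⋯⁅⁅x_{σ(1)}, x_{σ(2)}⁆, x_{σ(3)}⁆, ⋯, x_{σ(p)}⁆ = ∑_{σ ∈ Σ_p} x_{σ(1)}·x_{σ(2)}⋯x_{σ(p)}, where the left-hand brackets are left-nested iterated commutators, the left sum is over all permutations σ of {1,…,p} fixing 1, and the right sum is over all permutations σ of {1,…,p}. -/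
theorem sum_perm_cons {A M : Type*} [AddCommMonoid M] (n : ℕ) (y : Fin (n+1) → A) (g : List A → M) :
    ∑ σ : Equiv.Perm (Fin (n+1)), g (List.ofFn fun i => y (σ i)) =
      ∑ b : Fin (n+1), ∑ τ : Equiv.Perm (Fin n),
        g (y b :: List.ofFn fun i => y (Equiv.swap 0 b (τ i).succ)) := by
  rw [← Fintype.sum_prod_type', ← Equiv.sum_comp Equiv.Perm.decomposeFin.symm]
  refine Finset.sum_congr rfl fun x _ => ?_
  obtain ⟨b, τ⟩ := x
  rw [List.ofFn_succ]
  simp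

theorem sum_perm_reverse {A M : Type*} [AddCommMonoid M] (n : ℕ) (y : Fin n → A) (g : List A → M) :
    ∑ σ : Equiv.Perm (Fin n), g (List.ofFn fun i => y (σ i)).reverse =
      ∑ σ : Equiv.Perm (Fin n), g (List.ofFn fun i => y (σ i)) := by
  rw [← Equiv.sum_comp (Equiv.mulRight (Fin.revPerm : Equiv.Perm (Fin n)))]
  refine Finset.sum_congr rfl fun σ _ => ?_
  congr 1
  apply List.ext_getElem
  · simp
  · intro i h1 h2
    simp only [List.length_ofFn, List.length_reverse] at h1 h2
    simp only [List.getElem_reverse, List.getElem_ofFn, Equiv.coe_mulRight, Equiv.Perm.mul_apply,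
      Fin.revPerm_apply, List.length_ofFn]
    congr 2
    ext
    simp [Fin.rev]
    omega

theorem sum_perm_concat {A M : Type*} [AddCommMonoid M] (n : ℕ) (y : Fin (n+1) → A)
    (g : List A → M) :
    ∑ σ : Equiv.Perm (Fin (n+1)), g (List.ofFn fun i => y (σ i)) =
      ∑ b : Fin (n+1), ∑ τ : Equiv.Perm (Fin n),
        g ((List.ofFn fun i => y (Equiv.swap 0 b (τ i).succ)) ++ [y b]) := by
  rw [← sum_perm_reverse, sum_perm_cons n y (fun l => g l.reverse)]
  refine Finset.sum_congr rfl fun b _ => ?_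
  rw [← sum_perm_reverse n (fun i => y (Equiv.swap 0 b i.succ)) (fun l => g (l ++ [y b]))]
  simp

theorem sum_foldl_bracket {A : Type*} [Ring A] (a : A) (n : ℕ) : ∀ (y : Fin n → A),
    ∑ σ : Equiv.Perm (Fin n), (List.ofFn fun i => y (σ i)).foldl (fun a b => ⁅a, b⁆) a =
      ∑ σ : Equiv.Perm (Fin n), ∑ k ∈ Finset.range (n+1),
        ((-1 : ℤ)^k * (n.choose k : ℤ)) • (((List.ofFn fun i => y (σ i)).take k).prod * a *
          ((List.ofFn fun i => y (σ i)).drop k).prod) := by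
  induction n with
  | zero => intro y; simp
  | succ n ih =>
    intro y
    rw [sum_perm_concat n y (fun l => l.foldl (fun a b => ⁅a, b⁆) a)]
    have key : ∀ l : List A, ∑ k ∈ Finset.range (n+1+1),
        ((-1 : ℤ)^k * ((n+1).choose k : ℤ)) • ((l.take k).prod * a * (l.drop k).prod) =
        ∑ k ∈ Finset.range (n+1),
          ((-1 : ℤ)^k * (n.choose k : ℤ)) • ((l.take k).prod * a * (l.drop k).prod) -
        ∑ k ∈ Finset.range (n+1),
          ((-1 : ℤ)^k * (n.choose k : ℤ)) • ((l.take (k+1)).prod * a * (l.drop (k+1)).prod) := by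
      intro l
      have h1 : ∑ k ∈ Finset.range (n+1),
          ((-1 : ℤ)^k * (n.choose k : ℤ)) • ((l.take k).prod * a * (l.drop k).prod) =
          ∑ k ∈ Finset.range (n+1+1),
          ((-1 : ℤ)^k * (n.choose k : ℤ)) • ((l.take k).prod * a * (l.drop k).prod) := by
        rw [Finset.sum_range_succ _ (n+1)]
        simp
      rw [h1, Finset.sum_range_succ', Finset.sum_range_succ' _ (n+1), add_sub_right_comm,
        ← Finset.sum_sub_distrib]
      congr 1
      · refine Finset.sum_congr rfl fun k _ => ?_
        rw [← sub_smul]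
        congr 1
        rw [Nat.choose_succ_succ]
        push_cast
        ring
      · simp
    simp_rw [key]
    rw [Finset.sum_sub_distrib,
      sum_perm_concat n y (fun l => ∑ k ∈ Finset.range (n+1),
          ((-1 : ℤ)^k * (n.choose k : ℤ)) • ((l.take k).prod * a * (l.drop k).prod)),
      sum_perm_cons n y (fun l => ∑ k ∈ Finset.range (n+1),
          ((-1 : ℤ)^k * (n.choose k : ℤ)) • ((l.take (k+1)).prod * a * (l.drop (k+1)).prod)),
      ← Finset.sum_sub_distrib]
    refine Finset.sum_congr rfl fun b _ => ?_
    simp only [List.foldl_append, List.foldl_cons, List.foldl_nil, Ring.lie_def]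
    have := ih (fun i => y (Equiv.swap 0 b i.succ))
    simp only [Ring.lie_def] at this
    rw [Finset.sum_sub_distrib, ← Finset.sum_mul, ← Finset.mul_sum, this]
    congr 1
    · rw [Finset.sum_mul]
      refine Finset.sum_congr rfl fun τ _ => ?_
      rw [Finset.sum_mul]
      refine Finset.sum_congr rfl fun k hk => ?_
      have hk' : k ≤ n := by simpa [Nat.lt_succ_iff] using hk
      rw [List.take_append_of_le_length (by simpa using hk'),
        List.drop_append_of_le_length (by simpa using hk'), smul_mul_assoc]
      simp [mul_assoc]
    · rw [Finset.mul_sum]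
      refine Finset.sum_congr rfl fun τ _ => ?_
      rw [Finset.mul_sum]
      refine Finset.sum_congr rfl fun k hk => ?_
      rw [mul_smul_comm]
      simp [mul_assoc]

theorem neg_one_pow_choose (n k : ℕ) (hp : (n+1).Prime) (hk : k ≤ n) :
    (((-1 : ℤ)^k * (n.choose k : ℤ) : ℤ) : ZMod (n+1)) = 1 := by
  induction k with
  | zero => simp
  | succ k ih =>
    have h := ih (by omega)
    have h2 : (((n+1).choose (k+1) : ℕ) : ZMod (n+1)) = 0 := by
      rw [ZMod.natCast_eq_zero_iff]
      exact hp.dvd_choose_self (by omega) (by omega)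
    rw [Nat.choose_succ_succ] at h2
    push_cast at h h2 ⊢
    rw [pow_succ]
    linear_combination h - (-1)^k * h2

theorem ofFn_cycleRange {A : Type*} (n : ℕ) (x : Fin (n+1) → A) (k : Fin (n+1)) :
    (List.ofFn fun i => x (Fin.cycleRange k i)) =
      (List.ofFn fun i : Fin n => x i.succ).take k ++
        x 0 :: (List.ofFn fun i : Fin n => x i.succ).drop k := by
  have hk := k.2
  apply List.ext_getElem
  · simp; omega
  · intro i h1 h2
    simp only [List.length_ofFn] at h1
    rw [List.getElem_ofFn, List.getElem_append]
    split_ifs with h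
    · simp at h
      rw [Fin.cycleRange_of_lt (by simp [Fin.lt_def]; omega)]
      simp
      congr 1
      ext
      rw [Fin.val_add_one_of_lt (by simp [Fin.lt_def]; omega)]
    · simp at h
      rcases Nat.lt_or_ge k.1 i with h' | h'
      · rw [Fin.cycleRange_of_gt (by simpa [Fin.lt_def] using h')]
        rw [List.getElem_cons]
        simp
        rw [dif_neg (by omega)]
        congr 1
        ext
        simp
        omega
      · have : i = k := by omega
        subst this
        simp [min_eq_left (Nat.lt_succ_iff.1 hk)]

theorem sum_perm_position {A M : Type*} [AddCommMonoid M] (n : ℕ) (x : Fin (n+1) → A)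
    (g : List A → M) :
    ∑ σ : Equiv.Perm (Fin (n+1)), g (List.ofFn fun i => x (σ i)) =
      ∑ τ : Equiv.Perm (Fin n), ∑ k : Fin (n+1),
        g ((List.ofFn fun i : Fin n => x (τ i).succ).take k ++
          x 0 :: (List.ofFn fun i : Fin n => x (τ i).succ).drop k) := by
  rw [← Fintype.sum_prod_type']
  symm
  have hz : ∀ τ : Equiv.Perm (Fin n), Equiv.Perm.decomposeFin.symm (0, τ) 0 = 0 := by simp
  have hs : ∀ (τ : Equiv.Perm (Fin n)) i,
    Equiv.Perm.decomposeFin.symm (0, τ) (Fin.succ i) = (τ i).succ := by simp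
  refine Fintype.sum_bijective
    (fun q : Equiv.Perm (Fin n) × Fin (n+1) =>
      Equiv.Perm.decomposeFin.symm (0, q.1) * Fin.cycleRange q.2) ?_ _ _ ?_
  · rw [Fintype.bijective_iff_injective_and_card]
    constructor
    · rintro ⟨τ, k⟩ ⟨τ', k'⟩ h
      simp only at h
      have hk : k = k' := by
        have h1 := congrArg (fun e : Equiv.Perm (Fin (n+1)) => e k) h
        simp only [Equiv.Perm.mul_apply, Fin.cycleRange_self, hz] at h1
        have h2 : Fin.cycleRange k' k = 0 := by
          apply (Equiv.Perm.decomposeFin.symm (0, τ')).injective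
          rw [← h1, hz]
        apply (Fin.cycleRange k').injective
        rw [h2, Fin.cycleRange_self]
      subst hk
      have := mul_right_cancel h
      have := Equiv.Perm.decomposeFin.symm.injective this
      simp_all
    · simp [Fintype.card_perm, Nat.factorial_succ, mul_comm]
  · rintro ⟨τ, k⟩
    have := ofFn_cycleRange n (fun i => x (Equiv.Perm.decomposeFin.symm (0, τ) i)) k
    simp only [hz, hs] at this
    simp only [Equiv.Perm.mul_apply]
    rw [this]

/-- Let `p` be a prime and consider the free associative algebra over `𝔽_p`
on generators `x_1, …, x_p` (indexed by `Fin p`), with the commutator bracket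
`⁅a,b⁆ = a·b - b·a`.  Then
`∑_{σ ∈ Σ_p, σ(1)=1} ⁅⋯⁅⁅x_{σ(1)}, x_{σ(2)}⁆, x_{σ(3)}⁆, ⋯, x_{σ(p)}⁆
  = ∑_{σ ∈ Σ_p} x_{σ(1)} · x_{σ(2)} ⋯ x_{σ(p)}`,
where the left-hand brackets are left-nested iterated commutators (realized as a `foldl` of the
bracket over the tail of the list `[x_{σ(1)}, …, x_{σ(p)}]` starting from `x_{σ(1)}`). -/
theorem lie_invariant_w_eq_symmetrization (p : ℕ) (hp : p.Prime) :
    haveI : Fact p.Prime := ⟨hp⟩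
    (∑ σ ∈ Finset.univ.filter
        (fun σ : Equiv.Perm (Fin p) => σ ⟨0, hp.pos⟩ = ⟨0, hp.pos⟩),
      ((List.ofFn fun i : Fin p => FreeAlgebra.ι (ZMod p) (σ i)).tail).foldl
        (fun a b => ⁅a, b⁆) (FreeAlgebra.ι (ZMod p) (σ ⟨0, hp.pos⟩))) =
    ∑ σ : Equiv.Perm (Fin p),
      (List.ofFn fun i : Fin p => FreeAlgebra.ι (ZMod p) (σ i)).prod := by
  obtain ⟨n, rfl⟩ : ∃ n, p = n + 1 := ⟨p - 1, by have := hp.pos; omega⟩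
  have z : (⟨0, hp.pos⟩ : Fin (n+1)) = 0 := rfl
  simp only [z]
  rw [sum_perm_position n (fun i => FreeAlgebra.ι (ZMod (n+1)) i) List.prod]
  have hL := sum_foldl_bracket (FreeAlgebra.ι (ZMod (n+1)) (0 : Fin (n+1))) n
    (fun i => FreeAlgebra.ι (ZMod (n+1)) i.succ)
  rw [Finset.sum_filter, ← Equiv.sum_comp Equiv.Perm.decomposeFin.symm, Fintype.sum_prod_type,
    Finset.sum_eq_single 0]
  · simp only [List.ofFn_succ, List.tail_cons, Equiv.Perm.decomposeFin_symm_apply_zero, if_true,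
      Equiv.Perm.decomposeFin_symm_apply_succ, Equiv.swap_self, Equiv.refl_apply]
    rw [hL]
    refine Finset.sum_congr rfl fun τ _ => ?_
    rw [Finset.sum_range]
    refine Finset.sum_congr rfl fun k _ => ?_
    rw [← Int.cast_smul_eq_zsmul (ZMod (n+1)), neg_one_pow_choose n k hp (by omega)]
    simp [mul_assoc]
  · intro b _ hb
    refine Finset.sum_eq_zero fun τ _ => ?_
    simp [hb]
  · simp
end

section
/- Let p be a prime, R a commutative ring with p·1 = 0 in R, and A a commutative Hopf R-algebra with comultiplication Δ: A → A ⊗_R A. Call an R-linear derivation D: A → A left-invariant if (id_A ⊗ D) ∘ Δ = Δ ∘ D. If D is a left-invariant R-linear derivation of A, then the p-fold composite D^p = D ∘ ⋯ ∘ D is again a left-invariant R-linear derivation of A. -/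
open TensorProduct

/-- Let `p` be a prime, `R` a commutative ring with `p · 1 = 0` in `R`, and
`A` a commutative Hopf `R`-algebra with comultiplication `Δ : A → A ⊗[R] A`.  Call an
`R`-linear derivation `D : A → A` left-invariant if `(id_A ⊗ D) ∘ Δ = Δ ∘ D`.  If `D` is a
left-invariant `R`-linear derivation of `A`, then there is an `R`-linear derivation `D'` of `A`
whose underlying map is the `p`-fold composite `D^[p]`, and `D'` is again left-invariant. -/
theorem derivation_pow_p_left_invariant (p : ℕ) (hp : p.Prime)
    (R A : Type*) [CommRing R] [CommRing A] [HopfAlgebra R A]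
    (hchar : (p : R) = 0) (D : Derivation R A A)
    (hD : LinearMap.lTensor A D.toLinearMap ∘ₗ (Coalgebra.comul : A →ₗ[R] A ⊗[R] A) =
      (Coalgebra.comul : A →ₗ[R] A ⊗[R] A) ∘ₗ D.toLinearMap) :
    ∃ D' : Derivation R A A, ⇑D' = (⇑D)^[p] ∧
      LinearMap.lTensor A D'.toLinearMap ∘ₗ (Coalgebra.comul : A →ₗ[R] A ⊗[R] A) =
        (Coalgebra.comul : A →ₗ[R] A ⊗[R] A) ∘ₗ D'.toLinearMap := by
  let d : Module.End R A := D.toLinearMap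
  have hd : ∀ n : ℕ, ∀ a, (d ^ n) a = (⇑D)^[n] a := fun n a => by
    rw [Module.End.pow_apply]; rfl
  let X : Module.End R (A ⊗[R] A) := LinearMap.rTensor A d
  let Y : Module.End R (A ⊗[R] A) := LinearMap.lTensor A d
  have hXY : Commute X Y := by
    show X ∘ₗ Y = Y ∘ₗ X
    apply TensorProduct.ext'
    intro a b
    simp [X, Y]
  have h1 : ∀ t, d (LinearMap.mul' R A t) = LinearMap.mul' R A ((X + Y) t) := by
    intro t
    induction t with
    | zero => simp
    | add x y hx hy => simp only [map_add, hx, hy]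
    | tmul a b =>
      simp only [X, Y, LinearMap.add_apply, LinearMap.rTensor_tmul, LinearMap.lTensor_tmul,
        map_add, LinearMap.mul'_apply]
      show D (a * b) = D a * b + a * D b
      rw [D.leibniz, smul_eq_mul, smul_eq_mul]
      ring
  have hn : ∀ n : ℕ, ∀ t, (d ^ n) (LinearMap.mul' R A t) = LinearMap.mul' R A (((X + Y) ^ n) t) := by
    intro n
    induction n with
    | zero => intro t; simp
    | succ n ih =>
      intro t
      rw [pow_succ, pow_succ, Module.End.mul_apply, Module.End.mul_apply, h1, ih]
  have hp0 : ∀ r : Module.End R (A ⊗[R] A), (p : Module.End R (A ⊗[R] A)) * r = 0 := by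
    intro r
    rw [← nsmul_eq_mul, ← Nat.cast_smul_eq_nsmul R, hchar, zero_smul]
  have hleib : ∀ a b, (d ^ p) (a * b) = a • (d ^ p) b + b • (d ^ p) a := by
    intro a b
    obtain ⟨r, hr⟩ := hXY.exists_add_pow_prime_eq hp
    have h := hn p (a ⊗ₜ b)
    rw [hr] at h
    have e : ∀ z : Module.End R (A ⊗[R] A), X ^ p + Y ^ p + p * z = X ^ p + Y ^ p := by
      intro z; rw [hp0, add_zero]
    simp only [mul_assoc, e] at h
    simp only [X, Y, LinearMap.rTensor_pow, LinearMap.lTensor_pow, LinearMap.add_apply,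
      LinearMap.rTensor_tmul, LinearMap.lTensor_tmul, map_add, LinearMap.mul'_apply] at h
    rw [h, smul_eq_mul, smul_eq_mul]
    ring
  refine ⟨Derivation.mk' (d ^ p) hleib, funext fun a => hd p a, ?_⟩
  have hc : ∀ n : ℕ, LinearMap.lTensor A (d ^ n) ∘ₗ (Coalgebra.comul : A →ₗ[R] A ⊗[R] A) =
      (Coalgebra.comul : A →ₗ[R] A ⊗[R] A) ∘ₗ (d ^ n) := by
    intro n
    induction n with
    | zero => ext a; simp [Module.End.one_eq_id]
    | succ n ih =>
      have hD' : LinearMap.lTensor A d ∘ₗ (Coalgebra.comul : A →ₗ[R] A ⊗[R] A) =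
        (Coalgebra.comul : A →ₗ[R] A ⊗[R] A) ∘ₗ d := hD
      rw [pow_succ, Module.End.mul_eq_comp, LinearMap.lTensor_comp, LinearMap.comp_assoc, hD',
        ← LinearMap.comp_assoc, ih, LinearMap.comp_assoc]
  exact hc p
end
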